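/- Let P : [0,∞) → ℝ be C¹ with P ≥ 0, h C¹ on (0,∞) with h'(r) = P'(r)/r, g(ρ) = ∫₀^ρ h(r) dr, and assume there is λ > 0 with P(r) ≥ λ g(r) ≥ 0 for all r ≥ 0 and P(r)/r ≤ h(r) for all r > 0. Fix initial data ρ_I > 0 (C³ on [0,1]) and u_I (C² on [0,1]), boundary velocities u₀, u₁ with m := max(|u₀|,|u₁|) > 0, and constants M > 0, α > 1. Set M₀ := ∫₀¹ (1−2x) ρ_I u_I dx and E(0) := ∫₀¹ [½ρ_I u_I² + g(ρ_I) + ((√ρ_I)_x)²] dx, and assume E(0) > max(0, 4 M₀ M / m). Then there exists a finite T* (depending only on ρ_I, u_I, u₀, u₁, M, α, λ) such that every classical solution (ρ, u) of the 1D QHD system on [0,1]×[0,T] with ρ > 0, initial data (ρ_I, u_I), boundary conditions ρ_x(0,t) = ρ_x(1,t) = 0, u(0,t) = u₀, u(1,t) = u₁, with t ↦ ∫₀¹ u(x,t) dx constant in time, and with −M ≤ K(0,t) ≤ −α m² for all t ∈ [0,T], satisfies T ≤ T*. -/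

import Mathlib

open MeasureTheory Real Set

/-- Partial derivative in the first (space) variable. -/
noncomputable def pdx (f : ℝ → ℝ → ℝ) (x t : ℝ) : ℝ := deriv (fun y => f y t) x

/-- Partial derivative in the second (time) variable. -/
noncomputable def pdt (f : ℝ → ℝ → ℝ) (x t : ℝ) : ℝ := deriv (fun s => f x s) t

/-- Pointwise square root of a function of `(x, t)`. -/
noncomputable def sqf (ρ : ℝ → ℝ → ℝ) (x t : ℝ) : ℝ := Real.sqrt (ρ x t)

/-- A classical solution of the one-dimensional quantum hydrodynamic system (with ε² = 2)
`ρ_t + (ρu)_x = 0`, `(ρu)_t + (ρu² + P(ρ))_x = ρ·((√ρ)_xx/√ρ)_x` on `[0,1] × [0,T]`: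
`ρ > 0`, `ρ` of class `C¹` in `t` and `C³` in `x`, `u` of class `C¹` in `t` and `C²` in `x`,
all derivatives jointly continuous, and both equations hold pointwise. -/
structure IsQHDSolution1D (P : ℝ → ℝ) (ρ u : ℝ → ℝ → ℝ) (T : ℝ) : Prop where
  pos : ∀ x ∈ Set.Icc (0:ℝ) 1, ∀ t ∈ Set.Icc (0:ℝ) T, 0 < ρ x t
  rho_C3_x : ∀ t ∈ Set.Icc (0:ℝ) T, ContDiff ℝ 3 (fun x => ρ x t)
  rho_C1_t : ∀ x ∈ Set.Icc (0:ℝ) 1, ContDiff ℝ 1 (fun t => ρ x t)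
  u_C2_x : ∀ t ∈ Set.Icc (0:ℝ) T, ContDiff ℝ 2 (fun x => u x t)
  u_C1_t : ∀ x ∈ Set.Icc (0:ℝ) 1, ContDiff ℝ 1 (fun t => u x t)
  rho_cont : Continuous fun p : ℝ × ℝ => ρ p.1 p.2
  u_cont : Continuous fun p : ℝ × ℝ => u p.1 p.2
  rho_t_cont : Continuous fun p : ℝ × ℝ => pdt ρ p.1 p.2
  rho_x_cont : Continuous fun p : ℝ × ℝ => pdx ρ p.1 p.2
  rho_xx_cont : Continuous fun p : ℝ × ℝ => pdx (pdx ρ) p.1 p.2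
  rho_xxx_cont : Continuous fun p : ℝ × ℝ => pdx (pdx (pdx ρ)) p.1 p.2
  u_t_cont : Continuous fun p : ℝ × ℝ => pdt u p.1 p.2
  u_x_cont : Continuous fun p : ℝ × ℝ => pdx u p.1 p.2
  u_xx_cont : Continuous fun p : ℝ × ℝ => pdx (pdx u) p.1 p.2
  mass : ∀ x ∈ Set.Icc (0:ℝ) 1, ∀ t ∈ Set.Icc (0:ℝ) T,
    pdt ρ x t + pdx (fun y s => ρ y s * u y s) x t = 0
  momentum : ∀ x ∈ Set.Icc (0:ℝ) 1, ∀ t ∈ Set.Icc (0:ℝ) T,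
    pdt (fun y s => ρ y s * u y s) x t
      + pdx (fun y s => ρ y s * u y s ^ 2 + P (ρ y s)) x t
      = ρ x t * pdx (fun y s => pdx (pdx (sqf ρ)) y s / sqf ρ y s) x t

/-! ### Parametric integrals over rectangles -/

theorem continuousOn_slice {f : ℝ → ℝ → ℝ} {a b c d t : ℝ}
    (hf : ContinuousOn (fun p : ℝ × ℝ => f p.1 p.2) (Icc a b ×ˢ Icc c d)) (ht : t ∈ Icc c d) :
    ContinuousOn (fun x => f x t) (Icc a b) :=
  hf.comp (f := fun x => (x, t)) (by fun_prop) fun _ hx => ⟨hx, ht⟩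

theorem continuousOn_slice_right {f : ℝ → ℝ → ℝ} {a b c d x : ℝ}
    (hf : ContinuousOn (fun p : ℝ × ℝ => f p.1 p.2) (Icc a b ×ˢ Icc c d)) (hx : x ∈ Icc a b) :
    ContinuousOn (fun t => f x t) (Icc c d) :=
  hf.comp (f := fun t => (x, t)) (by fun_prop) fun _ ht => ⟨hx, ht⟩

theorem intervalIntegrable_slice {f : ℝ → ℝ → ℝ} {a b c d t : ℝ} (hab : a ≤ b)
    (hf : ContinuousOn (fun p : ℝ × ℝ => f p.1 p.2) (Icc a b ×ˢ Icc c d)) (ht : t ∈ Icc c d) :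
    IntervalIntegrable (fun x => f x t) volume a b :=
  (continuousOn_slice hf ht).intervalIntegrable_of_Icc hab

theorem aestronglyMeasurable_slice {f : ℝ → ℝ → ℝ} {a b c d t : ℝ} (hab : a ≤ b)
    (hf : ContinuousOn (fun p : ℝ × ℝ => f p.1 p.2) (Icc a b ×ˢ Icc c d)) (ht : t ∈ Icc c d) :
    AEStronglyMeasurable (fun x => f x t) (volume.restrict (uIoc a b)) := by
  have := (intervalIntegrable_slice hab hf ht).aestronglyMeasurable
  rwa [uIoc_of_le hab]

theorem exists_bound_rectangle {f : ℝ → ℝ → ℝ} {a b c d : ℝ}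
    (hf : ContinuousOn (fun p : ℝ × ℝ => f p.1 p.2) (Icc a b ×ˢ Icc c d)) :
    ∃ C, ∀ x ∈ Icc a b, ∀ t ∈ Icc c d, ‖f x t‖ ≤ C := by
  obtain ⟨C, hC⟩ := (isCompact_Icc.prod isCompact_Icc).exists_bound_of_continuousOn hf
  exact ⟨C, fun x hx t ht => hC (x, t) ⟨hx, ht⟩⟩

theorem continuousOn_integral_rectangle {f : ℝ → ℝ → ℝ} {a b c d : ℝ} (hab : a ≤ b)
    (hf : ContinuousOn (fun p : ℝ × ℝ => f p.1 p.2) (Icc a b ×ˢ Icc c d)) :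
    ContinuousOn (fun t => ∫ x in a..b, f x t) (Icc c d) := by
  obtain ⟨C, hC⟩ := exists_bound_rectangle hf
  intro t ht
  refine intervalIntegral.continuousWithinAt_of_dominated_interval (bound := fun _ => C)
    ?_ ?_ (by simp) ?_
  · filter_upwards [self_mem_nhdsWithin] with s hs using aestronglyMeasurable_slice hab hf hs
  · filter_upwards [self_mem_nhdsWithin] with s hs
    refine ae_of_all _ fun x hx => hC x ?_ s hs
    rw [uIoc_of_le hab] at hx
    exact Ioc_subset_Icc_self hx
  · refine ae_of_all _ fun x hx => ?_
    rw [uIoc_of_le hab] at hx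
    exact continuousOn_slice_right hf (Ioc_subset_Icc_self hx) t ht

/-- Differentiation under the integral sign over a rectangle. -/
theorem hasDerivAt_integral_rectangle {f f' : ℝ → ℝ → ℝ} {a b c d t : ℝ} (hab : a ≤ b)
    (hf : ContinuousOn (fun p : ℝ × ℝ => f p.1 p.2) (Icc a b ×ˢ Icc c d))
    (hf' : ContinuousOn (fun p : ℝ × ℝ => f' p.1 p.2) (Icc a b ×ˢ Icc c d))
    (hd : ∀ x ∈ Ioo a b, ∀ s ∈ Ioo c d, HasDerivAt (fun r => f x r) (f' x s) s)
    (ht : t ∈ Ioo c d) :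
    HasDerivAt (fun s => ∫ x in a..b, f x s) (∫ x in a..b, f' x t) t := by
  obtain ⟨C, hC⟩ := exists_bound_rectangle hf'
  have ht' := Ioo_subset_Icc_self ht
  refine (intervalIntegral.hasDerivAt_integral_of_dominated_loc_of_deriv_le
    (F := fun s x => f x s) (F' := fun s x => f' x s) (bound := fun _ => C)
    (Ioo_mem_nhds ht.1 ht.2) ?_ (intervalIntegrable_slice hab hf ht')
    (aestronglyMeasurable_slice hab hf' ht') ?_ (by simp) ?_).2
  · filter_upwards [Ioo_mem_nhds ht.1 ht.2] with s hs
      using aestronglyMeasurable_slice hab hf (Ioo_subset_Icc_self hs)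
  · refine ae_of_all _ fun x hx s hs => hC x ?_ s (Ioo_subset_Icc_self hs)
    rw [uIoc_of_le hab] at hx
    exact Ioc_subset_Icc_self hx
  · have hb : ∀ᵐ x : ℝ, x ≠ b := by simp [ae_iff]
    filter_upwards [hb] with x hxb hx s hs
    rw [uIoc_of_le hab] at hx
    exact hd x ⟨hx.1, lt_of_le_of_ne hx.2 hxb⟩ s hs

/-- If `a = f_x`, `b = f_t` and `c = b_x` on a rectangle, all continuous, then `a_t = c`. -/
theorem hasDerivAt_mixed_partial {f a b c : ℝ → ℝ → ℝ} {T : ℝ}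
    (hb : ContinuousOn (fun p : ℝ × ℝ => b p.1 p.2) (Icc 0 1 ×ˢ Icc 0 T))
    (hc : ContinuousOn (fun p : ℝ × ℝ => c p.1 p.2) (Icc 0 1 ×ˢ Icc 0 T))
    (hfx : ∀ x ∈ Ioo (0 : ℝ) 1, ∀ t ∈ Icc 0 T, HasDerivAt (fun y => f y t) (a x t) x)
    (hft : ∀ x ∈ Icc (0 : ℝ) 1, ∀ t ∈ Icc 0 T, HasDerivAt (fun s => f x s) (b x t) t)
    (hbx : ∀ x ∈ Ioo (0 : ℝ) 1, ∀ t ∈ Icc 0 T, HasDerivAt (fun y => b y t) (c x t) x)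
    {x t : ℝ} (hx : x ∈ Ioo (0 : ℝ) 1) (ht : t ∈ Ioo 0 T) :
    HasDerivAt (fun s => a x s) (c x t) t := by
  have hx' := Ioo_subset_Icc_self hx
  have key : ∀ s ∈ Ioo 0 T, a x s = a x 0 + ∫ r in (0 : ℝ)..s, c x r := by
    intro s hs
    have hsub : Icc 0 s ⊆ Icc 0 T := Icc_subset_Icc_right hs.2.le
    have hsub' : MapsTo Prod.swap (Icc 0 s ×ˢ Icc (0 : ℝ) 1) (Icc (0 : ℝ) 1 ×ˢ Icc 0 T) :=
      fun p hp => ⟨hp.2, hsub hp.1⟩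
    have h1 : HasDerivAt (fun y => ∫ r in (0 : ℝ)..s, b y r) (∫ r in (0 : ℝ)..s, c x r) x :=
      hasDerivAt_integral_rectangle (f := fun r y => b y r) (f' := fun r y => c y r) hs.1.le
        (hb.comp continuous_swap.continuousOn hsub') (hc.comp continuous_swap.continuousOn hsub')
        (fun r hr y hy => hbx y hy r (hsub (Ioo_subset_Icc_self hr))) hx
    have h2 : HasDerivAt (fun y => f y s - f y 0) (a x s - a x 0) x :=
      (hfx x hx s (Ioo_subset_Icc_self hs)).sub (hfx x hx 0 ⟨le_rfl, (hs.1.trans hs.2).le⟩)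
    have h3 : (fun y => ∫ r in (0 : ℝ)..s, b y r) =ᶠ[nhds x] fun y => f y s - f y 0 := by
      filter_upwards [Ioo_mem_nhds hx.1 hx.2] with y hy
      have hy' := Ioo_subset_Icc_self hy
      refine intervalIntegral.integral_eq_sub_of_hasDerivAt (fun r hr => hft y hy' r ?_) ?_
      · rw [uIcc_of_le hs.1.le] at hr
        exact hsub hr
      · exact ((continuousOn_slice_right hb hy').mono hsub).intervalIntegrable_of_Icc hs.1.le
    linarith [(h1.congr_of_eventuallyEq h3.symm).unique h2]
  have hcx := continuousOn_slice_right hc hx'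
  have hI : HasDerivAt (fun s => a x 0 + ∫ r in (0 : ℝ)..s, c x r) (c x t) t := by
    refine (intervalIntegral.integral_hasDerivAt_right
      ((hcx.mono (Icc_subset_Icc_right ht.2.le)).intervalIntegrable_of_Icc ht.1.le)
      ?_ (hcx.continuousAt (Icc_mem_nhds ht.1 ht.2))).const_add _
    exact (hcx.mono Ioo_subset_Icc_self).stronglyMeasurableAtFilter isOpen_Ioo t ht
  refine hI.congr_of_eventuallyEq ?_
  filter_upwards [Ioo_mem_nhds ht.1 ht.2] with s hs using key s hs

/-! ### The differential inequality behind the blow-up -/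

theorem antitoneOn_Icc_of_hasDerivAt {f f' : ℝ → ℝ} {T : ℝ} (hf : ContinuousOn f (Icc 0 T))
    (hd : ∀ t ∈ Ioo 0 T, HasDerivAt f (f' t) t) (hf' : ∀ t ∈ Ioo 0 T, f' t ≤ 0) :
    AntitoneOn f (Icc 0 T) := by
  refine antitoneOn_of_deriv_nonpos (convex_Icc _ _) hf ?_ ?_ <;> rw [interior_Icc]
  · exact fun t ht => (hd t ht).differentiableAt.differentiableWithinAt
  · intro t ht
    rw [(hd t ht).deriv]
    exact hf' t ht

/-- A nonnegative function `V` with `V' = W`, where `W' ≤ -a E` and `E' - b W' ≥ 0`, exists only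
up to a time controlled by the initial values, provided `E 0 - b * W 0 > 0`. -/
theorem lifespan_le {V W E W' E' : ℝ → ℝ} {T a b : ℝ} (hT : 0 ≤ T) (ha : 0 < a)
    (hb : 0 ≤ b)
    (hVc : ContinuousOn V (Icc 0 T)) (hWc : ContinuousOn W (Icc 0 T))
    (hEc : ContinuousOn E (Icc 0 T))
    (hV : ∀ t ∈ Ioo 0 T, HasDerivAt V (W t) t)
    (hW : ∀ t ∈ Ioo 0 T, HasDerivAt W (W' t) t)
    (hE : ∀ t ∈ Ioo 0 T, HasDerivAt E (E' t) t)
    (hV0 : ∀ t ∈ Icc 0 T, 0 ≤ V t)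
    (hWE : ∀ t ∈ Ioo 0 T, W' t ≤ -a * E t)
    (hEW : ∀ t ∈ Ioo 0 T, 0 ≤ E' t - b * W' t)
    (hZ : 0 < E 0 - b * W 0) :
    T ≤ 1 + 2 * (V 0 + |W 0 + a * b * V 0|) / (a * (E 0 - b * W 0)) := by
  set Z := E 0 - b * W 0 with hZdef
  set A := W 0 + a * b * V 0 with hA
  have h0 : (0 : ℝ) ∈ Icc 0 T := ⟨le_rfl, hT⟩
  have hTT : T ∈ Icc 0 T := ⟨hT, le_rfl⟩
  have hmono : ∀ t ∈ Icc 0 T, Z ≤ E t - b * W t := by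
    intro t ht
    have := antitoneOn_Icc_of_hasDerivAt (f := fun t => b * W t - E t)
      (f' := fun t => b * W' t - E' t) (by fun_prop)
      (fun t ht => ((hW t ht).const_mul b).sub (hE t ht))
      (fun t ht => by linarith [hEW t ht]) h0 ht ht.1
    simp only at this
    linarith
  have hW1 : ∀ t ∈ Icc 0 T, W t + a * b * V t + a * Z * t ≤ A := by
    intro t ht
    have := antitoneOn_Icc_of_hasDerivAt (f := fun t => W t + a * b * V t + a * Z * t)
      (f' := fun t => W' t + a * b * W t + a * Z * 1) (by fun_prop)
      (fun t ht => ((hW t ht).add ((hV t ht).const_mul _)).add ((hasDerivAt_id t).const_mul _))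
      (fun t ht => by
        have h1 := hWE t ht
        have h2 := mul_le_mul_of_nonneg_left (hmono t (Ioo_subset_Icc_self ht)) ha.le
        linarith) h0 ht ht.1
    simp only at this
    linarith
  have hVT : V T - A * T + a * Z / 2 * T ^ 2 ≤ V 0 := by
    have := antitoneOn_Icc_of_hasDerivAt (f := fun t => V t - A * t + a * Z / 2 * t ^ 2)
      (f' := fun t => W t - A * 1 + a * Z / 2 * (2 * t)) (by fun_prop)
      (fun t ht => ((hV t ht).sub ((hasDerivAt_id t).const_mul _)).add
        (((hasDerivAt_pow 2 t).congr_deriv (by simp)).const_mul _))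
      (fun t ht => by
        have h1 := hW1 t (Ioo_subset_Icc_self ht)
        have h2 := mul_nonneg (mul_nonneg ha.le hb) (hV0 t (Ioo_subset_Icc_self ht))
        linarith) h0 hTT hT
    simpa using this
  have haZ : 0 < a * Z := mul_pos ha hZ
  by_contra! hlt
  have hT1 : 1 < T :=
    (le_add_of_nonneg_right (by have := hV0 0 h0; positivity)).trans_lt hlt
  have h1 : 2 * (V 0 + |A|) < a * Z * T := by
    have h2 : 2 * (V 0 + |A|) / (a * Z) < T := by linarith
    rw [div_lt_iff₀ haZ] at h2
    linarith
  have h3 : A * T ≤ |A| * T := mul_le_mul_of_nonneg_right (le_abs_self A) hT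
  nlinarith [hV0 0 h0, hV0 T hTT, mul_lt_mul_of_pos_right h1 (zero_lt_one.trans hT1),
    mul_nonneg (hV0 0 h0) (sub_nonneg.2 hT1.le)]

/-! ### The enthalpy and the internal energy -/

theorem hasDerivAt_enthalpy {P h : ℝ → ℝ} (hh : ContDiffOn ℝ 1 h (Ioi 0))
    (hh' : ∀ r > (0 : ℝ), deriv h r = deriv P r / r) {r : ℝ} (hr : 0 < r) :
    HasDerivAt h (deriv P r / r) r := by
  rw [← hh' r hr]
  exact ((hh.differentiableOn one_ne_zero).differentiableAt (Ioi_mem_nhds hr)).hasDerivAt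

theorem hasDerivAt_pressure {P : ℝ → ℝ} (hP : ContDiffOn ℝ 1 P (Ici 0)) {r : ℝ} (hr : 0 < r) :
    HasDerivAt P (deriv P r) r :=
  ((hP.differentiableOn one_ne_zero).differentiableAt (Ici_mem_nhds hr)).hasDerivAt

/-- The enthalpy is integrable up to vacuum, because `r h(r) - P(r)` is a nonnegative
antiderivative of it. -/
theorem intervalIntegrable_enthalpy {P h : ℝ → ℝ} (hP : ContDiffOn ℝ 1 P (Ici 0))
    (hPnonneg : ∀ r ≥ (0 : ℝ), 0 ≤ P r) (hh : ContDiffOn ℝ 1 h (Ioi 0))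
    (hh' : ∀ r > (0 : ℝ), deriv h r = deriv P r / r) (hPh : ∀ r > (0 : ℝ), P r / r ≤ h r)
    {r : ℝ} (hr : 0 ≤ r) : IntervalIntegrable h volume 0 r := by
  have hd : ∀ s > (0 : ℝ), HasDerivAt (fun s => s * h s - P s) (h s) s := fun s hs =>
    (((hasDerivAt_id s).mul (hasDerivAt_enthalpy hh hh' hs)).sub
      (hasDerivAt_pressure hP hs)).congr_deriv (by simp; field_simp; ring)
  have hnonneg : ∀ s > (0 : ℝ), 0 ≤ h s := fun s hs =>
    (div_nonneg (hPnonneg s hs.le) hs.le).trans (hPh s hs)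
  have hmono : MonotoneOn (fun s => s * h s - P s) (Ioi 0) := by
    refine monotoneOn_of_deriv_nonneg (convex_Ioi 0)
      (fun s hs => (hd s hs).continuousAt.continuousWithinAt) ?_ ?_ <;> rw [interior_Ioi]
    · exact fun s hs => (hd s hs).differentiableAt.differentiableWithinAt
    · intro s hs
      rw [(hd s hs).deriv]
      exact hnonneg s hs
  have hmono' : MonotoneOn (fun s => if 0 < s then s * h s - P s else 0) (uIcc 0 r) := by
    intro a _ b _ hab
    by_cases ha : 0 < a
    · simpa only [if_pos ha, if_pos (ha.trans_le hab)] using hmono ha (ha.trans_le hab) hab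
    · by_cases hb : 0 < b
      · simp only [if_neg ha, if_pos hb]
        have := hPh b hb
        rw [div_le_iff₀ hb] at this
        linarith
      · simp only [if_neg ha, if_neg hb, le_refl]
  refine hmono'.intervalIntegrable_deriv.congr fun s hs => ?_
  rw [uIoc_of_le hr] at hs
  refine ((hd s hs.1).congr_of_eventuallyEq ?_).deriv
  filter_upwards [Ioi_mem_nhds hs.1] with y hy using if_pos hy

theorem hasDerivAt_internalEnergy {P h g : ℝ → ℝ} (hP : ContDiffOn ℝ 1 P (Ici 0))
    (hPnonneg : ∀ r ≥ (0 : ℝ), 0 ≤ P r) (hh : ContDiffOn ℝ 1 h (Ioi 0))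
    (hh' : ∀ r > (0 : ℝ), deriv h r = deriv P r / r) (hPh : ∀ r > (0 : ℝ), P r / r ≤ h r)
    (hg : ∀ r : ℝ, g r = ∫ s in (0 : ℝ)..r, h s) {r : ℝ} (hr : 0 < r) :
    HasDerivAt g (h r) r := by
  rw [funext hg]
  exact intervalIntegral.integral_hasDerivAt_right
    (intervalIntegrable_enthalpy hP hPnonneg hh hh' hPh hr.le)
    (hh.continuousOn.stronglyMeasurableAtFilter isOpen_Ioi r hr)
    (hh.continuousOn.continuousAt (Ioi_mem_nhds hr))

/-! ### Space derivatives and the quantum potential -/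

theorem contDiff_pdx {f : ℝ → ℝ → ℝ} {t : ℝ} {n : ℕ}
    (hf : ContDiff ℝ (n + 1) (fun x => f x t)) : ContDiff ℝ n (fun x => pdx f x t) :=
  (contDiff_succ_iff_deriv.1 hf).2.2

theorem hasDerivAt_pdx {f : ℝ → ℝ → ℝ} {t : ℝ} {n : ℕ}
    (hf : ContDiff ℝ (n + 1) (fun x => f x t)) (x : ℝ) :
    HasDerivAt (fun x => f x t) (pdx f x t) x :=
  ((contDiff_succ_iff_deriv.1 hf).1 x).hasDerivAt

theorem hasDerivAt_sqf {ρ : ℝ → ℝ → ℝ} {x t : ℝ} {n : ℕ}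
    (hρ : ContDiff ℝ (n + 1) (fun x => ρ x t)) (hpos : 0 < ρ x t) :
    HasDerivAt (fun y => sqf ρ y t) (pdx ρ x t / (2 * sqf ρ x t)) x :=
  (hasDerivAt_pdx hρ x).sqrt hpos.ne'

theorem sqf_pos {ρ : ℝ → ℝ → ℝ} {x t : ℝ} (hpos : 0 < ρ x t) : 0 < sqf ρ x t :=
  Real.sqrt_pos.2 hpos

theorem sq_sqf {ρ : ℝ → ℝ → ℝ} {x t : ℝ} (hpos : 0 < ρ x t) : sqf ρ x t ^ 2 = ρ x t :=
  Real.sq_sqrt hpos.le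

theorem eventually_pos {ρ : ℝ → ℝ → ℝ} {x t : ℝ} (hρ : ContDiff ℝ 3 (fun x => ρ x t))
    (hpos : 0 < ρ x t) : ∀ᶠ y in nhds x, 0 < ρ y t :=
  hρ.continuous.continuousAt.eventually (lt_mem_nhds hpos)

theorem quantumPotential_eq {ρ : ℝ → ℝ → ℝ} {x t : ℝ} (hρ : ContDiff ℝ 3 (fun x => ρ x t))
    (hpos : 0 < ρ x t) :
    pdx (pdx (sqf ρ)) x t / sqf ρ x t =
      pdx (pdx ρ) x t / (2 * ρ x t) - pdx ρ x t ^ 2 / (4 * ρ x t ^ 2) := by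
  have hs := sqf_pos hpos
  have h1 : HasDerivAt (fun y => pdx (sqf ρ) y t) _ x :=
    ((hasDerivAt_pdx (n := 1) (contDiff_pdx (n := 2) hρ) x).div
      ((hasDerivAt_sqf (n := 2) hρ hpos).const_mul 2) (mul_pos two_pos hs).ne').congr_of_eventuallyEq <| by
        filter_upwards [eventually_pos hρ hpos] with y hy
          using (hasDerivAt_sqf (n := 2) hρ hy).deriv
  rw [show pdx (pdx (sqf ρ)) x t = _ from h1.deriv, ← sq_sqf hpos]
  field_simp
  ring

theorem hasDerivAt_quantumPotential {ρ : ℝ → ℝ → ℝ} {x t : ℝ}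
    (hρ : ContDiff ℝ 3 (fun x => ρ x t)) (hpos : 0 < ρ x t) :
    HasDerivAt (fun y => pdx (pdx ρ) y t / (2 * ρ y t) - pdx ρ y t ^ 2 / (4 * ρ y t ^ 2))
      (pdx (pdx (pdx ρ)) x t / (2 * ρ x t) - pdx ρ x t * pdx (pdx ρ) x t / ρ x t ^ 2
        + pdx ρ x t ^ 3 / (2 * ρ x t ^ 3)) x := by
  have h0 := hasDerivAt_pdx (n := 2) hρ x
  have h1 := hasDerivAt_pdx (n := 1) (contDiff_pdx (n := 2) hρ) x
  have h2 := hasDerivAt_pdx (n := 0) (contDiff_pdx (n := 1) (contDiff_pdx (n := 2) hρ)) x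
  refine ((h2.div (h0.const_mul 2) (by positivity)).sub
    ((h1.pow 2).div ((h0.pow 2).const_mul 4)
      (show 4 * ρ x t ^ 2 ≠ 0 by positivity))).congr_deriv ?_
  simp
  field_simp
  ring

theorem pdx_quantumPotential {ρ : ℝ → ℝ → ℝ} {x t : ℝ}
    (hρ : ContDiff ℝ 3 (fun x => ρ x t)) (hpos : 0 < ρ x t) :
    pdx (fun y s => pdx (pdx (sqf ρ)) y s / sqf ρ y s) x t =
      pdx (pdx (pdx ρ)) x t / (2 * ρ x t) - pdx ρ x t * pdx (pdx ρ) x t / ρ x t ^ 2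
        + pdx ρ x t ^ 3 / (2 * ρ x t ^ 3) := by
  refine ((hasDerivAt_quantumPotential hρ hpos).congr_of_eventuallyEq ?_).deriv
  filter_upwards [eventually_pos hρ hpos] with y hy using quantumPotential_eq hρ hy

/-! ### Local balance laws -/

namespace IsQHDSolution1D

variable {P : ℝ → ℝ} {ρ u : ℝ → ℝ → ℝ} {T x t : ℝ}

/-- The mass flux divergence `(ρu)_x`. -/
noncomputable def divFlux (ρ u : ℝ → ℝ → ℝ) (x t : ℝ) : ℝ :=
  pdx ρ x t * u x t + ρ x t * pdx u x t

/-- The second derivative `(ρu)_xx`. -/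
noncomputable def divFluxDeriv (ρ u : ℝ → ℝ → ℝ) (x t : ℝ) : ℝ :=
  pdx (pdx ρ) x t * u x t + 2 * pdx ρ x t * pdx u x t + ρ x t * pdx (pdx u) x t

/-- The momentum flux `ρu² + P(ρ) - √ρ (√ρ)_xx + (√ρ)_x²`. -/
noncomputable def momentumFlux (P : ℝ → ℝ) (ρ u : ℝ → ℝ → ℝ) (x t : ℝ) : ℝ :=
  ρ x t * u x t ^ 2 + P (ρ x t) - pdx (pdx ρ) x t / 2 + pdx ρ x t ^ 2 / (2 * ρ x t)

/-- The iso-energy `K = u²/2 + h(ρ) - (√ρ)_xx / √ρ`, written without square roots. -/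
noncomputable def isoEnergy (h : ℝ → ℝ) (ρ u : ℝ → ℝ → ℝ) (x t : ℝ) : ℝ :=
  u x t ^ 2 / 2 + h (ρ x t)
    - (pdx (pdx ρ) x t / (2 * ρ x t) - pdx ρ x t ^ 2 / (4 * ρ x t ^ 2))

/-- The energy density `ρu²/2 + g(ρ) + (√ρ)_x²`. -/
noncomputable def energyDensity (g : ℝ → ℝ) (ρ u : ℝ → ℝ → ℝ) (x t : ℝ) : ℝ :=
  ρ x t * u x t ^ 2 / 2 + g (ρ x t) + pdx ρ x t ^ 2 / (4 * ρ x t)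

/-- The time derivative of the energy density. -/
noncomputable def energyDensityDeriv (h : ℝ → ℝ) (ρ u : ℝ → ℝ → ℝ) (x t : ℝ) : ℝ :=
  -divFlux ρ u x t * u x t ^ 2 / 2 + ρ x t * u x t * pdt u x t - h (ρ x t) * divFlux ρ u x t
    - pdx ρ x t * divFluxDeriv ρ u x t / (2 * ρ x t)
    + pdx ρ x t ^ 2 * divFlux ρ u x t / (4 * ρ x t ^ 2)

theorem hasDerivAt_rho (S : IsQHDSolution1D P ρ u T) (ht : t ∈ Icc 0 T) :
    HasDerivAt (fun y => ρ y t) (pdx ρ x t) x :=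
  hasDerivAt_pdx (n := 2) (S.rho_C3_x t ht) x

theorem hasDerivAt_rho_x (S : IsQHDSolution1D P ρ u T) (ht : t ∈ Icc 0 T) :
    HasDerivAt (fun y => pdx ρ y t) (pdx (pdx ρ) x t) x :=
  hasDerivAt_pdx (n := 1) (contDiff_pdx (n := 2) (S.rho_C3_x t ht)) x

theorem hasDerivAt_rho_xx (S : IsQHDSolution1D P ρ u T) (ht : t ∈ Icc 0 T) :
    HasDerivAt (fun y => pdx (pdx ρ) y t) (pdx (pdx (pdx ρ)) x t) x :=
  hasDerivAt_pdx (n := 0) (contDiff_pdx (n := 1) (contDiff_pdx (n := 2) (S.rho_C3_x t ht))) x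

theorem hasDerivAt_u (S : IsQHDSolution1D P ρ u T) (ht : t ∈ Icc 0 T) :
    HasDerivAt (fun y => u y t) (pdx u x t) x :=
  hasDerivAt_pdx (n := 1) (S.u_C2_x t ht) x

theorem hasDerivAt_u_x (S : IsQHDSolution1D P ρ u T) (ht : t ∈ Icc 0 T) :
    HasDerivAt (fun y => pdx u y t) (pdx (pdx u) x t) x :=
  hasDerivAt_pdx (n := 0) (contDiff_pdx (n := 1) (S.u_C2_x t ht)) x

theorem hasDerivAt_mul (S : IsQHDSolution1D P ρ u T) (ht : t ∈ Icc 0 T) :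
    HasDerivAt (fun y => ρ y t * u y t) (divFlux ρ u x t) x :=
  (S.hasDerivAt_rho ht).mul (S.hasDerivAt_u ht)

theorem hasDerivAt_divFlux (S : IsQHDSolution1D P ρ u T) (ht : t ∈ Icc 0 T) :
    HasDerivAt (fun y => divFlux ρ u y t) (divFluxDeriv ρ u x t) x :=
  (((S.hasDerivAt_rho_x ht).mul (S.hasDerivAt_u ht)).add
    ((S.hasDerivAt_rho ht).mul (S.hasDerivAt_u_x ht))).congr_deriv (by
      simp only [divFluxDeriv]; ring)

theorem pdt_rho (S : IsQHDSolution1D P ρ u T) (hx : x ∈ Icc (0 : ℝ) 1) (ht : t ∈ Icc 0 T) :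
    pdt ρ x t = -divFlux ρ u x t := by
  have h1 := S.mass x hx t ht
  rw [show pdx (fun y s => ρ y s * u y s) x t = _ from (S.hasDerivAt_mul ht).deriv] at h1
  linarith

theorem hasDerivAt_rho_t (S : IsQHDSolution1D P ρ u T) (hx : x ∈ Icc (0 : ℝ) 1)
    (ht : t ∈ Icc 0 T) : HasDerivAt (fun s => ρ x s) (-divFlux ρ u x t) t := by
  rw [← S.pdt_rho hx ht]
  exact ((S.rho_C1_t x hx).differentiable one_ne_zero t).hasDerivAt

theorem hasDerivAt_u_t (S : IsQHDSolution1D P ρ u T) (hx : x ∈ Icc (0 : ℝ) 1) :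
    HasDerivAt (fun s => u x s) (pdt u x t) t :=
  ((S.u_C1_t x hx).differentiable one_ne_zero t).hasDerivAt

theorem hasDerivAt_mul_t (S : IsQHDSolution1D P ρ u T) (hx : x ∈ Icc (0 : ℝ) 1)
    (ht : t ∈ Icc 0 T) :
    HasDerivAt (fun s => ρ x s * u x s) (-divFlux ρ u x t * u x t + ρ x t * pdt u x t) t :=
  (S.hasDerivAt_rho_t hx ht).mul (S.hasDerivAt_u_t hx)

/-- The momentum equation with all derivatives expanded. -/
theorem momentum_eq (S : IsQHDSolution1D P ρ u T) (hP : ContDiffOn ℝ 1 P (Ici 0))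
    (hx : x ∈ Icc (0 : ℝ) 1) (ht : t ∈ Icc 0 T) :
    -divFlux ρ u x t * u x t + ρ x t * pdt u x t
      + (pdx ρ x t * u x t ^ 2 + ρ x t * (2 * u x t * pdx u x t)
        + deriv P (ρ x t) * pdx ρ x t) =
    ρ x t * (pdx (pdx (pdx ρ)) x t / (2 * ρ x t) - pdx ρ x t * pdx (pdx ρ) x t / ρ x t ^ 2
        + pdx ρ x t ^ 3 / (2 * ρ x t ^ 3)) := by
  have hpos := S.pos x hx t ht
  have h1 : HasDerivAt (fun y => ρ y t * u y t ^ 2 + P (ρ y t))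
      (pdx ρ x t * u x t ^ 2 + ρ x t * (2 * u x t * pdx u x t)
        + deriv P (ρ x t) * pdx ρ x t) x :=
    (((S.hasDerivAt_rho ht).mul ((S.hasDerivAt_u ht).pow 2)).add
      ((hasDerivAt_pressure hP hpos).comp x (S.hasDerivAt_rho ht))).congr_deriv (by simp)
  rw [← pdx_quantumPotential (S.rho_C3_x t ht) hpos, ← S.momentum x hx t ht,
    show pdt (fun y s => ρ y s * u y s) x t = _ from (S.hasDerivAt_mul_t hx ht).deriv,
    show pdx (fun y s => ρ y s * u y s ^ 2 + P (ρ y s)) x t = _ from h1.deriv]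

theorem hasDerivAt_momentumFlux (S : IsQHDSolution1D P ρ u T) (hP : ContDiffOn ℝ 1 P (Ici 0))
    (hx : x ∈ Icc (0 : ℝ) 1) (ht : t ∈ Icc 0 T) :
    HasDerivAt (fun y => momentumFlux P ρ u y t)
      (-(-divFlux ρ u x t * u x t + ρ x t * pdt u x t)) x := by
  have hpos := S.pos x hx t ht
  have hρ := S.hasDerivAt_rho (x := x) ht
  refine ((((hρ.mul ((S.hasDerivAt_u ht).pow 2)).add
    ((hasDerivAt_pressure hP hpos).comp x hρ)).sub ((S.hasDerivAt_rho_xx ht).div_const 2)).add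
    (((S.hasDerivAt_rho_x ht).pow 2).div (hρ.const_mul 2) (by positivity))).congr_deriv ?_
  have h1 := S.momentum_eq hP hx ht
  rw [eq_neg_iff_add_eq_zero, ← sub_eq_zero.2 h1]
  simp
  field_simp
  ring

theorem hasDerivAt_isoEnergy {h : ℝ → ℝ} (S : IsQHDSolution1D P ρ u T)
    (hP : ContDiffOn ℝ 1 P (Ici 0)) (hh : ContDiffOn ℝ 1 h (Ioi 0))
    (hh' : ∀ r > (0 : ℝ), deriv h r = deriv P r / r)
    (hx : x ∈ Icc (0 : ℝ) 1) (ht : t ∈ Icc 0 T) :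
    HasDerivAt (fun y => isoEnergy h ρ u y t) (-pdt u x t) x := by
  have hpos := S.pos x hx t ht
  refine (((((S.hasDerivAt_u ht).pow 2).div_const 2).add
    ((hasDerivAt_enthalpy hh hh' hpos).comp x (S.hasDerivAt_rho ht))).sub
    (hasDerivAt_quantumPotential (S.rho_C3_x t ht) hpos)).congr_deriv ?_
  have h1 := S.momentum_eq hP hx ht
  rw [eq_neg_iff_add_eq_zero]
  refine (mul_eq_zero.1 (?_ : ρ x t * _ = 0)).resolve_left hpos.ne'
  rw [← sub_eq_zero.2 h1]
  simp [divFlux]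
  field_simp
  ring

/-- The local energy balance: the time derivative of the energy density is a divergence. -/
theorem hasDerivAt_energyFlux {h : ℝ → ℝ} (S : IsQHDSolution1D P ρ u T)
    (hP : ContDiffOn ℝ 1 P (Ici 0)) (hh : ContDiffOn ℝ 1 h (Ioi 0))
    (hh' : ∀ r > (0 : ℝ), deriv h r = deriv P r / r)
    (hx : x ∈ Icc (0 : ℝ) 1) (ht : t ∈ Icc 0 T) :
    HasDerivAt (fun y => -(ρ y t * u y t * isoEnergy h ρ u y t)
      - pdx ρ y t * divFlux ρ u y t / (2 * ρ y t)) (energyDensityDeriv h ρ u x t) x := by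
  have hpos := S.pos x hx t ht
  refine ((((S.hasDerivAt_mul ht).mul (S.hasDerivAt_isoEnergy hP hh hh' hx ht)).neg).sub
    (((S.hasDerivAt_rho_x ht).mul (S.hasDerivAt_divFlux ht)).div
      ((S.hasDerivAt_rho ht).const_mul 2) (by positivity))).congr_deriv ?_
  simp [energyDensityDeriv, isoEnergy]
  field_simp
  ring

theorem hasDerivAt_rho_x_t (S : IsQHDSolution1D P ρ u T) (hx : x ∈ Ioo (0 : ℝ) 1)
    (ht : t ∈ Ioo 0 T) : HasDerivAt (fun s => pdx ρ x s) (-divFluxDeriv ρ u x t) t := by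
  have h1 := S.rho_cont
  have h2 := S.rho_x_cont
  have h3 := S.rho_xx_cont
  have h4 := S.u_cont
  have h5 := S.u_x_cont
  have h6 := S.u_xx_cont
  exact hasDerivAt_mixed_partial (f := ρ) (b := fun x t => -divFlux ρ u x t)
    (c := fun x t => -divFluxDeriv ρ u x t)
    (by simp only [divFlux]; fun_prop) (by simp only [divFluxDeriv]; fun_prop)
    (fun x _ t ht => S.hasDerivAt_rho ht) (fun x hx t ht => S.hasDerivAt_rho_t hx ht)
    (fun x _ t ht => (S.hasDerivAt_divFlux ht).neg) hx ht

theorem hasDerivAt_energyDensity {h g : ℝ → ℝ} (S : IsQHDSolution1D P ρ u T)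
    (hg : ∀ r > (0 : ℝ), HasDerivAt g (h r) r) (hx : x ∈ Ioo (0 : ℝ) 1) (ht : t ∈ Ioo 0 T) :
    HasDerivAt (fun s => energyDensity g ρ u x s) (energyDensityDeriv h ρ u x t) t := by
  have hx' := Ioo_subset_Icc_self hx
  have ht' := Ioo_subset_Icc_self ht
  have hpos := S.pos x hx' t ht'
  have hρ := S.hasDerivAt_rho_t hx' ht'
  refine ((((hρ.mul ((S.hasDerivAt_u_t hx').pow 2)).div_const 2).add
    ((hg _ hpos).comp t hρ)).add
    (((S.hasDerivAt_rho_x_t hx ht).pow 2).div (hρ.const_mul 4) (by positivity))).congr_deriv ?_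
  simp [energyDensityDeriv]
  field_simp
  ring

/-! ### Evolution of the integrated quantities -/

theorem continuousOn_comp_rho {f : ℝ → ℝ} (S : IsQHDSolution1D P ρ u T)
    (hf : ContinuousOn f (Ioi 0)) :
    ContinuousOn (fun p : ℝ × ℝ => f (ρ p.1 p.2)) (Icc 0 1 ×ˢ Icc 0 T) :=
  hf.comp S.rho_cont.continuousOn fun p hp => S.pos p.1 hp.1 p.2 hp.2

theorem continuousOn_momentumFlux (S : IsQHDSolution1D P ρ u T)
    (hP : ContDiffOn ℝ 1 P (Ici 0)) :
    ContinuousOn (fun p : ℝ × ℝ => momentumFlux P ρ u p.1 p.2) (Icc 0 1 ×ˢ Icc 0 T) := by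
  have h1 := S.continuousOn_comp_rho (hP.continuousOn.mono Ioi_subset_Ici_self)
  have h2 := S.rho_cont
  have h3 := S.rho_x_cont
  have h4 := S.rho_xx_cont
  have h5 := S.u_cont
  have h6 : ∀ p ∈ Icc (0 : ℝ) 1 ×ˢ Icc 0 T, 2 * ρ p.1 p.2 ≠ 0 := fun p hp => by
    have := S.pos p.1 hp.1 p.2 hp.2
    positivity
  simp only [momentumFlux]
  refine ((ContinuousOn.add ?_ h1).sub ?_).add (ContinuousOn.div ?_ ?_ h6) <;> fun_prop

theorem continuousOn_energyDensity {g : ℝ → ℝ} (S : IsQHDSolution1D P ρ u T)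
    (hg : ContinuousOn g (Ioi 0)) :
    ContinuousOn (fun p : ℝ × ℝ => energyDensity g ρ u p.1 p.2) (Icc 0 1 ×ˢ Icc 0 T) := by
  have h1 := S.continuousOn_comp_rho hg
  have h2 := S.rho_cont
  have h3 := S.rho_x_cont
  have h5 := S.u_cont
  have h6 : ∀ p ∈ Icc (0 : ℝ) 1 ×ˢ Icc 0 T, 4 * ρ p.1 p.2 ≠ 0 := fun p hp => by
    have := S.pos p.1 hp.1 p.2 hp.2
    positivity
  simp only [energyDensity]
  refine (ContinuousOn.add ?_ h1).add (ContinuousOn.div ?_ ?_ h6) <;> fun_prop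

theorem continuousOn_energyDensityDeriv {h : ℝ → ℝ} (S : IsQHDSolution1D P ρ u T)
    (hh : ContinuousOn h (Ioi 0)) :
    ContinuousOn (fun p : ℝ × ℝ => energyDensityDeriv h ρ u p.1 p.2) (Icc 0 1 ×ˢ Icc 0 T) := by
  have h1 := S.continuousOn_comp_rho hh
  have h2 := S.rho_cont
  have h3 := S.rho_x_cont
  have h4 := S.rho_xx_cont
  have h5 := S.u_cont
  have h6 := S.u_x_cont
  have h7 := S.u_xx_cont
  have h8 := S.u_t_cont
  have h9 : ∀ p ∈ Icc (0 : ℝ) 1 ×ˢ Icc 0 T, 2 * ρ p.1 p.2 ≠ 0 := fun p hp => by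
    have := S.pos p.1 hp.1 p.2 hp.2
    positivity
  have h10 : ∀ p ∈ Icc (0 : ℝ) 1 ×ˢ Icc 0 T, 4 * ρ p.1 p.2 ^ 2 ≠ 0 := fun p hp => by
    have := S.pos p.1 hp.1 p.2 hp.2
    positivity
  simp only [energyDensityDeriv, divFlux, divFluxDeriv]
  refine ((ContinuousOn.sub ?_ (h1.mul ?_)).sub (ContinuousOn.div ?_ ?_ h9)).add
    (ContinuousOn.div ?_ ?_ h10) <;> fun_prop

theorem hasDerivAt_integral_weight_rho (S : IsQHDSolution1D P ρ u T) (ht : t ∈ Ioo 0 T) :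
    HasDerivAt (fun s => ∫ x in (0 : ℝ)..1, x * (1 - x) * ρ x s)
      (∫ x in (0 : ℝ)..1, (1 - 2 * x) * ρ x t * u x t) t := by
  have h1 := S.rho_cont
  have h2 := S.rho_x_cont
  have h3 := S.u_cont
  have h4 := S.u_x_cont
  have ht' := Ioo_subset_Icc_self ht
  have hc : Continuous fun p : ℝ × ℝ => p.1 * (1 - p.1) * -divFlux ρ u p.1 p.2 := by
    simp only [divFlux]; fun_prop
  have hc' : Continuous fun p : ℝ × ℝ => (1 - 2 * p.1) * ρ p.1 p.2 * u p.1 p.2 := by fun_prop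
  have hi1 := intervalIntegrable_slice zero_le_one (c := 0) (d := T)
    (f := fun x t => x * (1 - x) * -divFlux ρ u x t) hc.continuousOn ht'
  have hi2 := intervalIntegrable_slice zero_le_one (c := 0) (d := T)
    (f := fun x t => (1 - 2 * x) * ρ x t * u x t) hc'.continuousOn ht'
  have hd := hasDerivAt_integral_rectangle (f := fun x t => x * (1 - x) * ρ x t)
    (f' := fun x t => x * (1 - x) * -divFlux ρ u x t) (c := 0) (d := T) zero_le_one
    (by fun_prop) hc.continuousOn
    (fun x hx s hs => (S.hasDerivAt_rho_t (Ioo_subset_Icc_self hx)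
      (Ioo_subset_Icc_self hs)).const_mul _) ht
  refine hd.congr_deriv ?_
  have hF := intervalIntegral.integral_eq_sub_of_hasDerivAt
    (f := fun x => x * (1 - x) * (ρ x t * u x t)) (a := 0) (b := 1)
    (fun x _ => ((((hasDerivAt_id x).mul ((hasDerivAt_id x).const_sub 1)).mul
      (S.hasDerivAt_mul ht')).congr_deriv (g' := (1 - 2 * x) * ρ x t * u x t
        - x * (1 - x) * -divFlux ρ u x t) (by simp; ring))) (hi2.sub hi1)
  rw [intervalIntegral.integral_sub hi2 hi1] at hF
  simp at hF
  simp
  linarith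

theorem hasDerivAt_integral_weight_mul (S : IsQHDSolution1D P ρ u T)
    (hP : ContDiffOn ℝ 1 P (Ici 0)) (hbc : pdx ρ 0 t = 0 ∧ pdx ρ 1 t = 0) (ht : t ∈ Ioo 0 T) :
    HasDerivAt (fun s => ∫ x in (0 : ℝ)..1, (1 - 2 * x) * ρ x s * u x s)
      (momentumFlux P ρ u 0 t + momentumFlux P ρ u 1 t
        - ∫ x in (0 : ℝ)..1, (2 * momentumFlux P ρ u x t + pdx (pdx ρ) x t)) t := by
  have h1 := S.rho_cont
  have h2 := S.rho_x_cont
  have h3 := S.u_cont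
  have h4 := S.u_x_cont
  have h5 := S.u_t_cont
  have h6 := S.rho_xx_cont
  have ht' := Ioo_subset_Icc_self ht
  have hc : Continuous fun p : ℝ × ℝ =>
      (1 - 2 * p.1) * (-divFlux ρ u p.1 p.2 * u p.1 p.2 + ρ p.1 p.2 * pdt u p.1 p.2) := by
    simp only [divFlux]; fun_prop
  have hi1 := intervalIntegrable_slice zero_le_one (c := 0) (d := T) (f := fun x t =>
    (1 - 2 * x) * (-divFlux ρ u x t * u x t + ρ x t * pdt u x t)) hc.continuousOn ht'
  have hi1n : IntervalIntegrable (fun x =>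
      -((1 - 2 * x) * (-divFlux ρ u x t * u x t + ρ x t * pdt u x t))) volume 0 1 := hi1.neg
  have hi2 := intervalIntegrable_slice zero_le_one (c := 0) (d := T) (f := fun x t =>
    2 * momentumFlux P ρ u x t + pdx (pdx ρ) x t)
    (by have := S.continuousOn_momentumFlux hP; fun_prop) ht'
  have hd := hasDerivAt_integral_rectangle (f := fun x t => (1 - 2 * x) * (ρ x t * u x t))
    (f' := fun x t => (1 - 2 * x) * (-divFlux ρ u x t * u x t + ρ x t * pdt u x t))
    (c := 0) (d := T) zero_le_one (by fun_prop) hc.continuousOn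
    (fun x hx s hs => (S.hasDerivAt_mul_t (Ioo_subset_Icc_self hx)
      (Ioo_subset_Icc_self hs)).const_mul _) ht
  have hF := intervalIntegral.integral_eq_sub_of_hasDerivAt
    (f := fun x => (1 - 2 * x) * momentumFlux P ρ u x t - pdx ρ x t) (a := 0) (b := 1)
    (fun x hx => ((((((hasDerivAt_id x).const_mul 2).const_sub 1).mul
      (S.hasDerivAt_momentumFlux hP (by simpa using hx) ht')).sub
      (S.hasDerivAt_rho_x ht')).congr_deriv
        (g' := -((1 - 2 * x) * (-divFlux ρ u x t * u x t + ρ x t * pdt u x t))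
          - (2 * momentumFlux P ρ u x t + pdx (pdx ρ) x t)) (by simp; ring))) (hi1n.sub hi2)
  rw [intervalIntegral.integral_sub hi1n hi2, intervalIntegral.integral_neg] at hF
  simp only [← mul_assoc] at hd
  refine hd.congr_deriv ?_
  rw [hbc.1, hbc.2] at hF
  linarith

theorem hasDerivAt_integral_energyDensity {h g : ℝ → ℝ} (S : IsQHDSolution1D P ρ u T)
    (hP : ContDiffOn ℝ 1 P (Ici 0)) (hh : ContDiffOn ℝ 1 h (Ioi 0))
    (hh' : ∀ r > (0 : ℝ), deriv h r = deriv P r / r)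
    (hg : ∀ r > (0 : ℝ), HasDerivAt g (h r) r)
    (hbc : pdx ρ 0 t = 0 ∧ pdx ρ 1 t = 0) (ht : t ∈ Ioo 0 T) :
    HasDerivAt (fun s => ∫ x in (0 : ℝ)..1, energyDensity g ρ u x s)
      (ρ 0 t * u 0 t * isoEnergy h ρ u 0 t - ρ 1 t * u 1 t * isoEnergy h ρ u 1 t) t := by
  have ht' := Ioo_subset_Icc_self ht
  have hc := S.continuousOn_energyDensityDeriv hh.continuousOn
  refine (hasDerivAt_integral_rectangle zero_le_one
    (S.continuousOn_energyDensity fun r hr => (hg r hr).continuousAt.continuousWithinAt)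
    hc (fun x hx s hs => S.hasDerivAt_energyDensity hg hx hs) ht).congr_deriv ?_
  rw [intervalIntegral.integral_eq_sub_of_hasDerivAt
    (fun x hx => S.hasDerivAt_energyFlux hP hh hh' (by simpa using hx) ht')
    (intervalIntegrable_slice zero_le_one hc ht'), hbc.1, hbc.2]
  ring

/-- Conservation of `∫ u` forces the iso-energy to agree at both ends. -/
theorem isoEnergy_one_eq_zero {h : ℝ → ℝ} {c : ℝ} (S : IsQHDSolution1D P ρ u T)
    (hP : ContDiffOn ℝ 1 P (Ici 0)) (hh : ContDiffOn ℝ 1 h (Ioi 0))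
    (hh' : ∀ r > (0 : ℝ), deriv h r = deriv P r / r)
    (hu : ∀ s ∈ Icc 0 T, ∫ x in (0 : ℝ)..1, u x s = c) (ht : t ∈ Ioo 0 T) :
    isoEnergy h ρ u 1 t = isoEnergy h ρ u 0 t := by
  have ht' := Ioo_subset_Icc_self ht
  have hd := hasDerivAt_integral_rectangle (f := u) (f' := pdt u) zero_le_one
    S.u_cont.continuousOn S.u_t_cont.continuousOn
    (fun x hx s _ => S.hasDerivAt_u_t (Ioo_subset_Icc_self hx)) ht
  have hd0 : HasDerivAt (fun s => ∫ x in (0 : ℝ)..1, u x s) 0 t :=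
    (hasDerivAt_const t c).congr_of_eventuallyEq <| by
      filter_upwards [Ioo_mem_nhds ht.1 ht.2] with s hs using hu s (Ioo_subset_Icc_self hs)
  have hF := intervalIntegral.integral_eq_sub_of_hasDerivAt (a := 0) (b := 1)
    (fun x hx => S.hasDerivAt_isoEnergy hP hh hh' (by simpa using hx) ht')
    (intervalIntegrable_slice zero_le_one (f := fun x t => -pdt u x t) (c := 0) (d := T)
      S.u_t_cont.neg.continuousOn ht')
  rw [intervalIntegral.integral_neg, hd.unique hd0] at hF
  linarith

theorem momentumFlux_le_of_neumann {h : ℝ → ℝ} (hpos : 0 < ρ x t)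
    (hPh : P (ρ x t) / ρ x t ≤ h (ρ x t)) (hbc : pdx ρ x t = 0) :
    momentumFlux P ρ u x t ≤ ρ x t * (isoEnergy h ρ u x t + u x t ^ 2 / 2) := by
  rw [div_le_iff₀ hpos] at hPh
  have : ρ x t * (isoEnergy h ρ u x t + u x t ^ 2 / 2) =
      ρ x t * u x t ^ 2 + h (ρ x t) * ρ x t - pdx (pdx ρ) x t / 2 := by
    simp only [isoEnergy, hbc]
    field_simp
    ring
  rw [this, momentumFlux, hbc]
  simp
  linarith

theorem energyDensity_nonneg {g : ℝ → ℝ} (hpos : 0 < ρ x t)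
    (hg : ∀ r ≥ (0 : ℝ), 0 ≤ g r) : 0 ≤ energyDensity g ρ u x t := by
  have := hg _ hpos.le
  simp only [energyDensity]
  positivity

theorem mul_energyDensity_le {g : ℝ → ℝ} {lam : ℝ} (hpos : 0 < ρ x t)
    (hg : ∀ r ≥ (0 : ℝ), 0 ≤ g r) (hPg : ∀ r ≥ (0 : ℝ), lam * g r ≤ P r) :
    2 * min 2 lam * energyDensity g ρ u x t
      ≤ 2 * momentumFlux P ρ u x t + pdx (pdx ρ) x t := by
  have h1 : min 2 lam * (ρ x t * u x t ^ 2 / 2) ≤ 2 * (ρ x t * u x t ^ 2 / 2) := by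
    gcongr; exact min_le_left _ _
  have h2 : min 2 lam * g (ρ x t) ≤ P (ρ x t) :=
    (mul_le_mul_of_nonneg_right (min_le_right _ _) (hg _ hpos.le)).trans (hPg _ hpos.le)
  have h3 : min 2 lam * (pdx ρ x t ^ 2 / (4 * ρ x t)) ≤ 2 * (pdx ρ x t ^ 2 / (4 * ρ x t)) := by
    gcongr; exact min_le_left _ _
  have h4 : pdx ρ x t ^ 2 / (2 * ρ x t) = 2 * (pdx ρ x t ^ 2 / (4 * ρ x t)) := by
    field_simp; ring
  simp only [energyDensity, momentumFlux, h4]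
  linarith

theorem integral_energyDensity_zero {g ρI uI : ℝ → ℝ} (S : IsQHDSolution1D P ρ u T)
    (hT : 0 ≤ T) (hρ : ∀ x ∈ Icc (0 : ℝ) 1, ρ x 0 = ρI x)
    (hu : ∀ x ∈ Icc (0 : ℝ) 1, u x 0 = uI x) :
    ∫ x in (0 : ℝ)..1, energyDensity g ρ u x 0 = ∫ x in (0 : ℝ)..1,
      (ρI x * uI x ^ 2 / 2 + g (ρI x) + (deriv (fun y => Real.sqrt (ρI y)) x) ^ 2) := by
  have h0 : (0 : ℝ) ∈ Icc 0 T := ⟨le_rfl, hT⟩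
  simp only [intervalIntegral.integral_of_le zero_le_one, integral_Ioc_eq_integral_Ioo]
  refine setIntegral_congr_fun measurableSet_Ioo fun x hx => ?_
  have hx' := Ioo_subset_Icc_self hx
  have hpos := S.pos x hx' 0 h0
  have hd : HasDerivAt (fun y => Real.sqrt (ρI y)) (pdx ρ x 0 / (2 * sqf ρ x 0)) x := by
    refine (hasDerivAt_sqf (n := 2) (S.rho_C3_x 0 h0) hpos).congr_of_eventuallyEq ?_
    filter_upwards [Ioo_mem_nhds hx.1 hx.2] with y hy
    rw [sqf, hρ y (Ioo_subset_Icc_self hy)]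
  simp only [energyDensity]
  rw [hd.deriv, div_pow, mul_pow, sq_sqf hpos, hρ x hx', hu x hx']
  norm_num

end IsQHDSolution1D

/-- Blow-up in finite time for the 1D QHD system with Dirichlet velocity boundary conditions:
under the structural pressure assumptions `P ≥ λ g ≥ 0` and `P(ρ)/ρ ≤ h(ρ)`, for initial data
with large enough energy `E(0)`, there is a finite time `T*` (depending only on the data)
bounding the lifespan of every classical solution whose boundary iso-energy value `K(0,t)`
satisfies `−M ≤ K(0,t) ≤ −α·max(|u₀|,|u₁|)²`. -/
theorem qhd1d_blowup_dirichlet_velocity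
    (P h : ℝ → ℝ) (hP : ContDiffOn ℝ 1 P (Set.Ici 0)) (hPnonneg : ∀ r ≥ (0:ℝ), 0 ≤ P r)
    (hh : ContDiffOn ℝ 1 h (Set.Ioi 0))
    (hh' : ∀ r > (0:ℝ), deriv h r = deriv P r / r)
    (g : ℝ → ℝ) (hg : ∀ r : ℝ, g r = ∫ s in (0:ℝ)..r, h s)
    (lam : ℝ) (hlam : 0 < lam)
    (hgnonneg : ∀ r ≥ (0:ℝ), 0 ≤ g r)
    (hPg : ∀ r ≥ (0:ℝ), lam * g r ≤ P r)
    (hPh : ∀ r > (0:ℝ), P r / r ≤ h r)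
    (ρI uI : ℝ → ℝ) (hρI : ContDiff ℝ 3 ρI) (hρIpos : ∀ x ∈ Set.Icc (0:ℝ) 1, 0 < ρI x)
    (huI : ContDiff ℝ 2 uI)
    (u₀ u₁ M α : ℝ) (hm : 0 < max |u₀| |u₁|) (hM : 0 < M) (hα : 1 < α)
    (M₀ E₀ : ℝ) (hM₀ : M₀ = ∫ x in (0:ℝ)..1, (1 - 2 * x) * ρI x * uI x)
    (hE₀ : E₀ = ∫ x in (0:ℝ)..1,
      (ρI x * uI x ^ 2 / 2 + g (ρI x) + (deriv (fun y => Real.sqrt (ρI y)) x) ^ 2))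
    (hE₀big : max 0 (4 * M₀ * M / max |u₀| |u₁|) < E₀) :
    ∃ Tstar : ℝ, ∀ T : ℝ, 0 ≤ T → ∀ ρ u : ℝ → ℝ → ℝ,
      IsQHDSolution1D P ρ u T →
      (∀ x ∈ Set.Icc (0:ℝ) 1, ρ x 0 = ρI x) →
      (∀ x ∈ Set.Icc (0:ℝ) 1, u x 0 = uI x) →
      (∀ t ∈ Set.Icc (0:ℝ) T, pdx ρ 0 t = 0 ∧ pdx ρ 1 t = 0) →
      (∀ t ∈ Set.Icc (0:ℝ) T, u 0 t = u₀ ∧ u 1 t = u₁) →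
      (∀ t ∈ Set.Icc (0:ℝ) T, (∫ x in (0:ℝ)..1, u x t) = ∫ x in (0:ℝ)..1, uI x) →
      (∀ t ∈ Set.Icc (0:ℝ) T,
        -M ≤ u 0 t ^ 2 / 2 + h (ρ 0 t) - pdx (pdx (sqf ρ)) 0 t / sqf ρ 0 t ∧
        u 0 t ^ 2 / 2 + h (ρ 0 t) - pdx (pdx (sqf ρ)) 0 t / sqf ρ 0 t
          ≤ -α * (max |u₀| |u₁|) ^ 2) →
      T ≤ Tstar := by
  set m := max |u₀| |u₁| with hmdef
  set a := 2 * min 2 lam with hadef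
  set b := 2 * M / m with hbdef
  set V₀ := ∫ x in (0:ℝ)..1, x * (1 - x) * ρI x with hV₀
  have ha : 0 < a := by positivity
  have hb : 0 ≤ b := by positivity
  refine ⟨1 + 2 * (V₀ + |M₀ + a * b * V₀|) / (a * (E₀ - b * M₀)),
    fun T hT ρ u S hρ0 hu0 hbc hu huint hK => ?_⟩
  have hg' : ∀ r > (0 : ℝ), HasDerivAt g (h r) r := fun r hr =>
    hasDerivAt_internalEnergy hP hPnonneg hh hh' hPh hg hr
  have hgc : ContinuousOn g (Ioi 0) := fun r hr => (hg' r hr).continuousAt.continuousWithinAt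
  have h0 : (0 : ℝ) ∈ Icc (0 : ℝ) 1 := ⟨le_rfl, zero_le_one⟩
  have h1 : (1 : ℝ) ∈ Icc (0 : ℝ) 1 := ⟨zero_le_one, le_rfl⟩
  have ht0 : (0 : ℝ) ∈ Icc 0 T := ⟨le_rfl, hT⟩
  have hVeq : (∫ x in (0:ℝ)..1, x * (1 - x) * ρ x 0) = V₀ :=
    intervalIntegral.integral_congr fun x hx => by
      rw [uIcc_of_le zero_le_one] at hx
      simp only [hρ0 x hx]
  have hWeq : (∫ x in (0:ℝ)..1, (1 - 2 * x) * ρ x 0 * u x 0) = M₀ := by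
    rw [hM₀]
    refine intervalIntegral.integral_congr fun x hx => ?_
    rw [uIcc_of_le zero_le_one] at hx
    simp only [hρ0 x hx, hu0 x hx]
  have hEeq : (∫ x in (0:ℝ)..1, IsQHDSolution1D.energyDensity g ρ u x 0) = E₀ := by
    rw [hE₀, S.integral_energyDensity_zero hT hρ0 hu0]
  have hcW : Continuous fun p : ℝ × ℝ => (1 - 2 * p.1) * ρ p.1 p.2 * u p.1 p.2 := by
    have := S.rho_cont
    have := S.u_cont
    fun_prop
  have hcV : Continuous fun p : ℝ × ℝ => p.1 * (1 - p.1) * ρ p.1 p.2 := by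
    have := S.rho_cont
    fun_prop
  have hcE := S.continuousOn_energyDensity hgc
  rw [← hVeq, ← hWeq, ← hEeq]
  have hKb : ∀ t ∈ Ioo 0 T,
      IsQHDSolution1D.isoEnergy h ρ u 1 t = IsQHDSolution1D.isoEnergy h ρ u 0 t ∧
      -M ≤ IsQHDSolution1D.isoEnergy h ρ u 0 t ∧
      IsQHDSolution1D.isoEnergy h ρ u 0 t ≤ -α * m ^ 2 := by
    intro t ht
    have ht' := Ioo_subset_Icc_self ht
    have := hK t ht'
    rw [quantumPotential_eq (S.rho_C3_x t ht') (S.pos 0 h0 t ht')] at this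
    exact ⟨S.isoEnergy_one_eq_zero hP hh hh' huint ht, this⟩
  have hu₀ : |u₀| ≤ m := le_max_left _ _
  have hu₁ : |u₁| ≤ m := le_max_right _ _
  have hWle : ∀ t ∈ Ioo 0 T, IsQHDSolution1D.momentumFlux P ρ u 0 t
      + IsQHDSolution1D.momentumFlux P ρ u 1 t
      - ∫ x in (0 : ℝ)..1, (2 * IsQHDSolution1D.momentumFlux P ρ u x t + pdx (pdx ρ) x t) ≤
      -(ρ 0 t + ρ 1 t) * (m ^ 2 / 2)
        - a * ∫ x in (0:ℝ)..1, IsQHDSolution1D.energyDensity g ρ u x t := by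
    intro t ht
    have ht' := Ioo_subset_Icc_self ht
    obtain ⟨hK1, -, hK2⟩ := hKb t ht
    have hp0 := S.pos 0 h0 t ht'
    have hp1 := S.pos 1 h1 t ht'
    have hF0 := IsQHDSolution1D.momentumFlux_le_of_neumann (u := u) hp0 (hPh _ hp0) (hbc t ht').1
    have hF1 := IsQHDSolution1D.momentumFlux_le_of_neumann (u := u) hp1 (hPh _ hp1) (hbc t ht').2
    rw [(hu t ht').1] at hF0
    rw [(hu t ht').2, hK1] at hF1
    have hsq0 : u₀ ^ 2 ≤ m ^ 2 := sq_le_sq' (abs_le.1 hu₀).1 (abs_le.1 hu₀).2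
    have hsq1 : u₁ ^ 2 ≤ m ^ 2 := sq_le_sq' (abs_le.1 hu₁).1 (abs_le.1 hu₁).2
    have hm2 : m ^ 2 ≤ α * m ^ 2 := le_mul_of_one_le_left (sq_nonneg m) hα.le
    have hB0 := mul_le_mul_of_nonneg_left
      (show IsQHDSolution1D.isoEnergy h ρ u 0 t + u₀ ^ 2 / 2 ≤ -(m ^ 2 / 2) by linarith) hp0.le
    have hB1 := mul_le_mul_of_nonneg_left
      (show IsQHDSolution1D.isoEnergy h ρ u 0 t + u₁ ^ 2 / 2 ≤ -(m ^ 2 / 2) by linarith) hp1.le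
    have hI : a * ∫ x in (0:ℝ)..1, IsQHDSolution1D.energyDensity g ρ u x t ≤
        ∫ x in (0 : ℝ)..1, (2 * IsQHDSolution1D.momentumFlux P ρ u x t + pdx (pdx ρ) x t) := by
      rw [← intervalIntegral.integral_const_mul]
      refine intervalIntegral.integral_mono_on zero_le_one
        ((intervalIntegrable_slice zero_le_one hcE ht').const_mul _) ?_
        fun x hx => IsQHDSolution1D.mul_energyDensity_le (S.pos x hx t ht') hgnonneg hPg
      have hcF := S.continuousOn_momentumFlux hP
      have := S.rho_xx_cont
      exact intervalIntegrable_slice zero_le_one (c := 0) (d := T) (f := fun x t =>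
        2 * IsQHDSolution1D.momentumFlux P ρ u x t + pdx (pdx ρ) x t) (by fun_prop) ht'
    linarith
  refine lifespan_le hT ha hb
    (continuousOn_integral_rectangle (f := fun x t => x * (1 - x) * ρ x t) zero_le_one
      hcV.continuousOn)
    (continuousOn_integral_rectangle (f := fun x t => (1 - 2 * x) * ρ x t * u x t) zero_le_one
      hcW.continuousOn)
    (continuousOn_integral_rectangle zero_le_one hcE)
    (fun t ht => S.hasDerivAt_integral_weight_rho ht)
    (fun t ht => S.hasDerivAt_integral_weight_mul hP (hbc t (Ioo_subset_Icc_self ht)) ht)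
    (fun t ht => S.hasDerivAt_integral_energyDensity hP hh hh' hg'
      (hbc t (Ioo_subset_Icc_self ht)) ht) ?_ ?_ ?_ ?_
  · refine fun t ht => intervalIntegral.integral_nonneg zero_le_one fun x hx => ?_
    exact mul_nonneg (mul_nonneg hx.1 (sub_nonneg.2 hx.2)) (S.pos x hx t ht).le
  · intro t ht
    have ht' := Ioo_subset_Icc_self ht
    have := hWle t ht
    have := mul_nonneg (add_pos (S.pos 0 h0 t ht') (S.pos 1 h1 t ht')).le
      (show 0 ≤ m ^ 2 / 2 by positivity)
    linarith
  · intro t ht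
    have ht' := Ioo_subset_Icc_self ht
    obtain ⟨hK1, hK2, hK3⟩ := hKb t ht
    rw [hK1, (hu t ht').1, (hu t ht').2]
    have hE0 : 0 ≤ ∫ x in (0:ℝ)..1, IsQHDSolution1D.energyDensity g ρ u x t :=
      intervalIntegral.integral_nonneg zero_le_one fun x hx =>
        IsQHDSolution1D.energyDensity_nonneg (S.pos x hx t ht') hgnonneg
    have hbW := mul_le_mul_of_nonneg_left (hWle t ht) hb
    have hbm : b * (m ^ 2 / 2) = M * m := by
      rw [hbdef]
      field_simp
    have hKabs : |IsQHDSolution1D.isoEnergy h ρ u 0 t| ≤ M := by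
      refine abs_le.2 ⟨hK2, hK3.trans ?_⟩
      have : 0 ≤ α * m ^ 2 := by positivity
      linarith
    have hb0 := (abs_le.1 (show |u₀ * IsQHDSolution1D.isoEnergy h ρ u 0 t| ≤ m * M by
      rw [abs_mul]; gcongr)).1
    have hb1 := (abs_le.1 (show |u₁ * IsQHDSolution1D.isoEnergy h ρ u 0 t| ≤ m * M by
      rw [abs_mul]; gcongr)).2
    have hb0' := mul_le_mul_of_nonneg_left hb0 (S.pos 0 h0 t ht').le
    have hb1' := mul_le_mul_of_nonneg_left hb1 (S.pos 1 h1 t ht').le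
    have hba := mul_nonneg (mul_nonneg hb ha.le) hE0
    linear_combination hbW + hb0' + hb1' + hba - (ρ 0 t + ρ 1 t) * hbm
  · rw [hEeq, hWeq]
    have hq : 4 * M₀ * M / m = 2 * (b * M₀) := by
      rw [hbdef]
      ring
    rw [hq, max_lt_iff] at hE₀big
    linarith [hE₀big.1, hE₀big.2]
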